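/- arXiv:1302.4517 — 3 statements merged into one kernel-verified Lean document; each statement's English description precedes it below -/
import Mathlib

section
/- If the 4×4 complex Hermitian matrix Q is positive semidefinite, then E₀² ≥ c₄² + (1/2)|c|² + (1/2)|Ĵ|² + (1/2)c₄'². (This is inequality (ine1) in the proof of the positive energy theorem, obtained from the nonnegativity of the second-order principal minors of Q; equivalently E₀ ≥ √(c₄² + (1/4)|L|²) with |L|² = 2(|c|² + |Ĵ|² + c₄'²).) -/
noncomputable section

open Matrix
open scoped ComplexOrder

/-- Euclidean dot product on ℝ³. -/
def dot3 (u v : Fin 3 → ℝ) : ℝ := u 0 * v 0 + u 1 * v 1 + u 2 * v 2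

/-- Cross product on ℝ³. -/
def cross3 (u v : Fin 3 → ℝ) : Fin 3 → ℝ :=
  ![u 1 * v 2 - u 2 * v 1, u 2 * v 0 - u 0 * v 2, u 0 * v 1 - u 1 * v 0]

/-- Euclidean norm on ℝ³. -/
def norm3 (u : Fin 3 → ℝ) : ℝ := Real.sqrt (dot3 u u)

/-- The 4×4 Hermitian matrix Q = [[E, L], [L*, Ê]] from the positive energy theorem. -/
def Qmat (E₀ c₁ c₂ c₃ c₄ c₁' c₂' c₃' c₄' J₁₂ J₁₃ J₂₃ J₁₄ J₂₄ J₃₄ : ℝ) :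
    Matrix (Fin 4) (Fin 4) ℂ :=
  !![((E₀ + c₄ + c₃' - J₃₄ : ℝ) : ℂ),
     (c₁' : ℂ) + Complex.I * (c₂' : ℂ) - (J₁₄ : ℂ) - Complex.I * (J₂₄ : ℂ),
     (c₃ : ℂ) - (c₄' : ℂ) + Complex.I * (J₁₂ : ℂ),
     (c₁ : ℂ) + Complex.I * (c₂ : ℂ) + (J₁₃ : ℂ) + Complex.I * (J₂₃ : ℂ);
     (c₁' : ℂ) - Complex.I * (c₂' : ℂ) - (J₁₄ : ℂ) + Complex.I * (J₂₄ : ℂ),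
     ((E₀ + c₄ - c₃' + J₃₄ : ℝ) : ℂ),
     (c₁ : ℂ) - Complex.I * (c₂ : ℂ) - (J₁₃ : ℂ) + Complex.I * (J₂₃ : ℂ),
     -(c₃ : ℂ) - (c₄' : ℂ) - Complex.I * (J₁₂ : ℂ);
     (c₃ : ℂ) - (c₄' : ℂ) - Complex.I * (J₁₂ : ℂ),
     (c₁ : ℂ) + Complex.I * (c₂ : ℂ) - (J₁₃ : ℂ) - Complex.I * (J₂₃ : ℂ),
     ((E₀ - c₄ - c₃' - J₃₄ : ℝ) : ℂ),
     -(c₁' : ℂ) - Complex.I * (c₂' : ℂ) - (J₁₄ : ℂ) - Complex.I * (J₂₄ : ℂ);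
     (c₁ : ℂ) - Complex.I * (c₂ : ℂ) + (J₁₃ : ℂ) - Complex.I * (J₂₃ : ℂ),
     -(c₃ : ℂ) - (c₄' : ℂ) + Complex.I * (J₁₂ : ℂ),
     -(c₁' : ℂ) + Complex.I * (c₂' : ℂ) - (J₁₄ : ℂ) + Complex.I * (J₂₄ : ℂ),
     ((E₀ - c₄ + c₃' + J₃₄ : ℝ) : ℂ)]

/-- The second-order principal minors of a positive semidefinite matrix are nonnegative. -/
theorem Matrix.PosSemidef.normSq_apply_le {n : Type*} {A : Matrix n n ℂ} (hA : A.PosSemidef)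
    (i j : n) : Complex.normSq (A i j) ≤ (A i i).re * (A j j).re := by
  have hdet := (hA.submatrix ![i, j]).det_nonneg
  have hji : A j i = star (A i j) := (hA.1.apply j i).symm
  have hii : (A i i).im = 0 := Complex.conj_eq_iff_im.mp (hA.1.apply i i)
  rw [det_fin_two] at hdet
  have hre := (Complex.le_def.mp hdet).1
  simp [hji, hii, Complex.mul_re] at hre
  rw [Complex.normSq_apply]
  linarith

/-- The squared Euclidean norm is the sum of the squared coordinates. -/
theorem norm3_sq (x y z : ℝ) : norm3 ![x, y, z] ^ 2 = x ^ 2 + y ^ 2 + z ^ 2 := by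
  have h : dot3 ![x, y, z] ![x, y, z] = x ^ 2 + y ^ 2 + z ^ 2 := by
    simp [dot3, sq]
  rw [norm3, h, Real.sq_sqrt (by positivity)]

theorem stmt1 (E₀ c₁ c₂ c₃ c₄ c₁' c₂' c₃' c₄' J₁₂ J₁₃ J₂₃ J₁₄ J₂₄ J₃₄ : ℝ)
    (hQ : (Qmat E₀ c₁ c₂ c₃ c₄ c₁' c₂' c₃' c₄' J₁₂ J₁₃ J₂₃ J₁₄ J₂₄ J₃₄).PosSemidef) :
    E₀ ^ 2 ≥ c₄ ^ 2 + (1 / 2) * norm3 ![c₁, c₂, c₃] ^ 2 + (1 / 2) * norm3 ![J₂₃, -J₁₃, J₁₂] ^ 2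
      + (1 / 2) * c₄' ^ 2 := by
  have h13 := hQ.normSq_apply_le 0 2
  have h14 := hQ.normSq_apply_le 0 3
  have h23 := hQ.normSq_apply_le 1 2
  have h24 := hQ.normSq_apply_le 1 3
  simp [Qmat, Complex.normSq_apply] at h13 h14 h23 h24
  rw [norm3_sq, norm3_sq]
  linarith
end
end

section
/- If the 4×4 complex Hermitian matrix Q is positive semidefinite, then E₀² ≥ (1/2)(|c'|² + |J₍₄₎|²) + (1/4)(|c|² + |Ĵ|²) + (1/4)c₄'². (This is inequality (ine2) in the proof of the positive energy theorem, obtained from the nonnegativity of the second-order principal minors of Q.) -/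
noncomputable section

open Matrix
open scoped ComplexOrder

/-- The principal minors of order two of a positive semidefinite matrix are nonnegative. -/
theorem Matrix.PosSemidef.principal_minor_two_nonneg {n : Type*} {M : Matrix n n ℂ}
    (hM : M.PosSemidef) (i j : n) : 0 ≤ (M i i * M j j - M i j * M j i).re := by
  have h := (hM.submatrix ![i, j]).det_nonneg
  rw [Matrix.det_fin_two] at h
  simpa using (Complex.le_def.mp h).1

theorem norm3_sq_s2 (u : Fin 3 → ℝ) : norm3 u ^ 2 = u 0 ^ 2 + u 1 ^ 2 + u 2 ^ 2 := by
  rw [norm3, dot3, Real.sq_sqrt (by nlinarith [sq_nonneg (u 0), sq_nonneg (u 1), sq_nonneg (u 2)])]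
  ring

theorem stmt2 (E₀ c₁ c₂ c₃ c₄ c₁' c₂' c₃' c₄' J₁₂ J₁₃ J₂₃ J₁₄ J₂₄ J₃₄ : ℝ)
    (hQ : (Qmat E₀ c₁ c₂ c₃ c₄ c₁' c₂' c₃' c₄' J₁₂ J₁₃ J₂₃ J₁₄ J₂₄ J₃₄).PosSemidef) :
    E₀ ^ 2 ≥ (1 / 2) * (norm3 ![c₁', c₂', c₃'] ^ 2 + norm3 ![J₁₄, J₂₄, J₃₄] ^ 2)
      + (1 / 4) * (norm3 ![c₁, c₂, c₃] ^ 2 + norm3 ![J₂₃, -J₁₃, J₁₂] ^ 2) + (1 / 4) * c₄' ^ 2 := by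
  have h₁₂ := hQ.principal_minor_two_nonneg 0 1
  have h₁₃ := hQ.principal_minor_two_nonneg 0 2
  have h₁₄ := hQ.principal_minor_two_nonneg 0 3
  have h₂₃ := hQ.principal_minor_two_nonneg 1 2
  have h₂₄ := hQ.principal_minor_two_nonneg 1 3
  have h₃₄ := hQ.principal_minor_two_nonneg 2 3
  simp [Qmat] at h₁₂ h₁₃ h₁₄ h₂₃ h₂₄ h₃₄
  simp only [norm3_sq_s2, Matrix.cons_val]
  linarith
end
end

section
/- If the 4×4 complex Hermitian matrix Q is positive semidefinite, then E₀² ≥ A − 2√2·√D. (In the paper this is derived from the nonnegativity of the sum of the third-order principal minors of Q combined with a Cauchy–Schwarz estimate.) -/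
noncomputable section

open Matrix
open scoped ComplexOrder

theorem sq_norm3 (u : Fin 3 → ℝ) : norm3 u ^ 2 = dot3 u u := by
  rw [norm3, Real.sq_sqrt]
  simp only [dot3]
  nlinarith [mul_self_nonneg (u 0), mul_self_nonneg (u 1), mul_self_nonneg (u 2)]

/-- The principal minors of a positive semidefinite complex matrix have nonnegative real part. -/
theorem Matrix.PosSemidef.re_det_submatrix_nonneg {n m : Type*} [Fintype n] [Fintype m]
    [DecidableEq m] {M : Matrix n n ℂ} (hM : M.PosSemidef) (f : m → n) :
    0 ≤ (M.submatrix f f).det.re :=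
  (Complex.nonneg_iff.mp (hM.submatrix f).det_nonneg).1

section

variable {E₀ c₁ c₂ c₃ c₄ c₁' c₂' c₃' c₄' J₁₂ J₁₃ J₂₃ J₁₄ J₂₄ J₃₄ : ℝ}

/-- The sum of the third-order principal minors of `Qmat`. -/
theorem Qmat_sum_third_minors_nonneg
    (hQ : (Qmat E₀ c₁ c₂ c₃ c₄ c₁' c₂' c₃' c₄' J₁₂ J₁₃ J₂₃ J₁₄ J₂₄ J₃₄).PosSemidef) :
    0 ≤ E₀ ^ 3 - (c₄ ^ 2 + c₄' ^ 2 + (c₁ ^ 2 + c₂ ^ 2 + c₃ ^ 2) + (c₁' ^ 2 + c₂' ^ 2 + c₃' ^ 2) +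
        (J₂₃ ^ 2 + J₁₃ ^ 2 + J₁₂ ^ 2) + (J₁₄ ^ 2 + J₂₄ ^ 2 + J₃₄ ^ 2)) * E₀
      - 2 * (J₁₄ * (c₄ * c₁' - c₄' * c₁) + J₂₄ * (c₄ * c₂' - c₄' * c₂)
        + J₃₄ * (c₄ * c₃' - c₄' * c₃) + c₁' * (c₂ * J₁₂ + c₃ * J₁₃)
        + c₂' * (c₃ * J₂₃ - c₁ * J₁₂) - c₃' * (c₁ * J₁₃ + c₂ * J₂₃)) := by
  have h₀ := hQ.re_det_submatrix_nonneg ![1, 2, 3]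
  have h₁ := hQ.re_det_submatrix_nonneg ![0, 2, 3]
  have h₂ := hQ.re_det_submatrix_nonneg ![0, 1, 3]
  have h₃ := hQ.re_det_submatrix_nonneg ![0, 1, 2]
  rw [Matrix.det_fin_three] at h₀ h₁ h₂ h₃
  simp [Qmat] at h₀ h₁ h₂ h₃
  linarith

/-- The sum of the second-order principal minors of `Qmat`. -/
theorem Qmat_sum_second_minors_nonneg
    (hQ : (Qmat E₀ c₁ c₂ c₃ c₄ c₁' c₂' c₃' c₄' J₁₂ J₁₃ J₂₃ J₁₄ J₂₄ J₃₄).PosSemidef) :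
    c₄ ^ 2 + c₄' ^ 2 + (c₁ ^ 2 + c₂ ^ 2 + c₃ ^ 2) + (c₁' ^ 2 + c₂' ^ 2 + c₃' ^ 2) +
      (J₂₃ ^ 2 + J₁₃ ^ 2 + J₁₂ ^ 2) + (J₁₄ ^ 2 + J₂₄ ^ 2 + J₃₄ ^ 2) ≤ 3 * E₀ ^ 2 := by
  have h₀ := hQ.re_det_submatrix_nonneg ![0, 1]
  have h₁ := hQ.re_det_submatrix_nonneg ![0, 2]
  have h₂ := hQ.re_det_submatrix_nonneg ![0, 3]
  have h₃ := hQ.re_det_submatrix_nonneg ![1, 2]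
  have h₄ := hQ.re_det_submatrix_nonneg ![1, 3]
  have h₅ := hQ.re_det_submatrix_nonneg ![2, 3]
  rw [Matrix.det_fin_two] at h₀ h₁ h₂ h₃ h₄ h₅
  simp [Qmat] at h₀ h₁ h₂ h₃ h₄ h₅
  linarith

theorem abs_le_of_Qmat_posSemidef
    (hQ : (Qmat E₀ c₁ c₂ c₃ c₄ c₁' c₂' c₃' c₄' J₁₂ J₁₃ J₂₃ J₁₄ J₂₄ J₃₄).PosSemidef) : |c₄| ≤ E₀ := by
  have h₀ := hQ.re_det_submatrix_nonneg ![0]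
  have h₁ := hQ.re_det_submatrix_nonneg ![1]
  have h₂ := hQ.re_det_submatrix_nonneg ![2]
  have h₃ := hQ.re_det_submatrix_nonneg ![3]
  rw [Matrix.det_fin_one] at h₀ h₁ h₂ h₃
  simp [Qmat] at h₀ h₁ h₂ h₃
  exact abs_le.mpr ⟨by linarith, by linarith⟩

theorem sq_add_sq_le_of_Qmat_posSemidef
    (hQ : (Qmat E₀ c₁ c₂ c₃ c₄ c₁' c₂' c₃' c₄' J₁₂ J₁₃ J₂₃ J₁₄ J₂₄ J₃₄).PosSemidef) :
    J₁₄ ^ 2 + J₂₄ ^ 2 + J₃₄ ^ 2 + (c₁' ^ 2 + c₂' ^ 2 + c₃' ^ 2) ≤ 2 * E₀ ^ 2 := by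
  have hc := sq_le_sq' (abs_le.mp (abs_le_of_Qmat_posSemidef hQ)).1
    (abs_le.mp (abs_le_of_Qmat_posSemidef hQ)).2
  have h₀ := hQ.re_det_submatrix_nonneg ![0, 1]
  have h₁ := hQ.re_det_submatrix_nonneg ![2, 3]
  rw [Matrix.det_fin_two] at h₀ h₁
  simp [Qmat] at h₀ h₁
  linarith

end

/-- Cauchy–Schwarz in six real variables. -/
theorem abs_sum_six_mul_le (a₁ a₂ a₃ a₄ a₅ a₆ b₁ b₂ b₃ b₄ b₅ b₆ : ℝ) :
    |a₁ * b₁ + a₂ * b₂ + a₃ * b₃ + a₄ * b₄ + a₅ * b₅ + a₆ * b₆| ≤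
      √(a₁ ^ 2 + a₂ ^ 2 + a₃ ^ 2 + (a₄ ^ 2 + a₅ ^ 2 + a₆ ^ 2)) *
        √(b₁ ^ 2 + b₂ ^ 2 + b₃ ^ 2 + (b₄ ^ 2 + b₅ ^ 2 + b₆ ^ 2)) := by
  rw [← Real.sqrt_mul (by positivity)]
  apply Real.abs_le_sqrt
  have h := Finset.sum_mul_sq_le_sq_mul_sq Finset.univ ![a₁, a₂, a₃, a₄, a₅, a₆]
    ![b₁, b₂, b₃, b₄, b₅, b₆]
  simp [Fin.sum_univ_succ] at h
  linarith

theorem stmt4 (E₀ c₁ c₂ c₃ c₄ c₁' c₂' c₃' c₄' J₁₂ J₁₃ J₂₃ J₁₄ J₂₄ J₃₄ : ℝ)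
    (hQ : (Qmat E₀ c₁ c₂ c₃ c₄ c₁' c₂' c₃' c₄' J₁₂ J₁₃ J₂₃ J₁₄ J₂₄ J₃₄).PosSemidef) :
    E₀ ^ 2 ≥ (c₄ ^ 2 + c₄' ^ 2 + norm3 ![c₁, c₂, c₃] ^ 2 + norm3 ![c₁', c₂', c₃'] ^ 2 + norm3 ![J₂₃, -J₁₃, J₁₂] ^ 2 + norm3 ![J₁₄, J₂₄, J₃₄] ^ 2) - 2 * Real.sqrt 2 * Real.sqrt ((c₄ * c₁' - c₄' * c₁) ^ 2 + (c₄ * c₂' - c₄' * c₂) ^ 2 + (c₄ * c₃' - c₄' * c₃) ^ 2 + norm3 (cross3 ![c₁, c₂, c₃] ![J₂₃, -J₁₃, J₁₂]) ^ 2) := by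
  have hE : 0 ≤ E₀ := (abs_nonneg _).trans (abs_le_of_Qmat_posSemidef hQ)
  have hA := Qmat_sum_second_minors_nonneg hQ
  have h3 := Qmat_sum_third_minors_nonneg hQ
  have hJ := sq_add_sq_le_of_Qmat_posSemidef hQ
  have hCS := abs_sum_six_mul_le J₁₄ J₂₄ J₃₄ c₁' c₂' c₃' (c₄ * c₁' - c₄' * c₁)
    (c₄ * c₂' - c₄' * c₂) (c₄ * c₃' - c₄' * c₃) (c₂ * J₁₂ + c₃ * J₁₃)
    (c₃ * J₂₃ - c₁ * J₁₂) (-(c₁ * J₁₃ + c₂ * J₂₃))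
  have hsqrt : √(J₁₄ ^ 2 + J₂₄ ^ 2 + J₃₄ ^ 2 + (c₁' ^ 2 + c₂' ^ 2 + c₃' ^ 2)) ≤ √2 * E₀ := by
    refine Real.sqrt_le_iff.mpr ⟨by positivity, ?_⟩
    rwa [mul_pow, Real.sq_sqrt zero_le_two]
  simp only [sq_norm3, dot3, cross3, Matrix.cons_val_zero, Matrix.cons_val_one,
    Matrix.cons_val]
  have hD : (c₄ * c₁' - c₄' * c₁) ^ 2 + (c₄ * c₂' - c₄' * c₂) ^ 2 + (c₄ * c₃' - c₄' * c₃) ^ 2 +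
      ((c₂ * J₁₂ + c₃ * J₁₃) ^ 2 + (c₃ * J₂₃ - c₁ * J₁₂) ^ 2 + (-(c₁ * J₁₃ + c₂ * J₂₃)) ^ 2) =
      (c₄ * c₁' - c₄' * c₁) ^ 2 + (c₄ * c₂' - c₄' * c₂) ^ 2 + (c₄ * c₃' - c₄' * c₃) ^ 2 +
      ((c₂ * J₁₂ - c₃ * -J₁₃) * (c₂ * J₁₂ - c₃ * -J₁₃) +
        (c₃ * J₂₃ - c₁ * J₁₂) * (c₃ * J₂₃ - c₁ * J₁₂) +
        (c₁ * -J₁₃ - c₂ * J₂₃) * (c₁ * -J₁₃ - c₂ * J₂₃)) := by ring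
  rw [← hD]
  set s := √((c₄ * c₁' - c₄' * c₁) ^ 2 + (c₄ * c₂' - c₄' * c₂) ^ 2 + (c₄ * c₃' - c₄' * c₃) ^ 2 +
      ((c₂ * J₁₂ + c₃ * J₁₃) ^ 2 + (c₃ * J₂₃ - c₁ * J₁₂) ^ 2 + (-(c₁ * J₁₃ + c₂ * J₂₃)) ^ 2))
  have hs : 0 ≤ s := Real.sqrt_nonneg _
  have hS := (neg_le_abs _).trans (hCS.trans (mul_le_mul_of_nonneg_right hsqrt hs))
  rcases hE.eq_or_lt with rfl | hpos
  · have : 0 ≤ 2 * √2 * s := by positivity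
    linarith
  · refine le_of_mul_le_mul_right ?_ hpos
    linarith
end
end
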